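/- Let v, q, m, s, R be positive integers with v ≥ 2, q ≥ 2 and 0 < R < ms. Then K_{vq}(m, s, R) ≤ OCAN(ms − R, m, s, v) · K_q(m, s, R). -/

import Mathlib

/-- An anti-ideal of the NRT poset `[m·s]`, whose elements are pairs
`(i, a) : Fin m × Fin s` (block `i`, position `a` within the block, positions
within a block forming a chain): an anti-ideal is an up-closed subset. -/
def IsAntiIdeal (m s : ℕ) (J : Finset (Fin m × Fin s)) : Prop :=
  ∀ i : Fin m, ∀ a b : Fin s, a ≤ b → (i, a) ∈ J → (i, b) ∈ J

/-- Existence of an ordered covering array `OCA_λ(N; t, m, s, v)`: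
an `N × ms` array over an alphabet of size `v`, columns indexed by the NRT poset
`[m·s]`, such that for every anti-ideal `J` of size `t`, every `t`-tuple appears
at least `lam` times as a row of the subarray given by the columns in `J`. -/
def IsOCA (lam N t m s v : ℕ) : Prop :=
  ∃ A : Fin N → Fin m × Fin s → Fin v,
    ∀ J : Finset (Fin m × Fin s), IsAntiIdeal m s J → J.card = t →
      ∀ f : Fin m × Fin s → Fin v,
        lam ≤ (Finset.univ.filter (fun r : Fin N => ∀ c ∈ J, A r c = f c)).card

/-- The ordered covering array number `OCAN_λ(t, m, s, v)`. -/
noncomputable def OCAN (lam t m s v : ℕ) : ℕ := sInf {N | IsOCA lam N t m s v}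

/-- The NRT distance on `Z_q^{ms}` (coordinates indexed by `Fin m × Fin s`,
block `i`, position `a` within block): the cardinality of the ideal of the NRT
poset `[m·s]` generated by the support of `x - y`; a coordinate `(i, a)` lies in
this ideal iff `x` and `y` differ at some `(i, b)` with `a ≤ b`. -/
def nrtDist (m s q : ℕ) (x y : Fin m × Fin s → Fin q) : ℕ :=
  (Finset.univ.filter (fun c : Fin m × Fin s =>
    ∃ b : Fin s, c.2 ≤ b ∧ x (c.1, b) ≠ y (c.1, b))).card

/-- `nrtK q m s R` is the smallest cardinality of an `R`-covering code of the
NRT space `Z_q^{ms}`. -/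
noncomputable def nrtK (q m s R : ℕ) : ℕ :=
  sInf {n | ∃ C : Finset (Fin m × Fin s → Fin q), C.card = n ∧
    ∀ x : Fin m × Fin s → Fin q, ∃ c ∈ C, nrtDist m s q x c ≤ R}

/-- An anti-ideal contains anti-ideals of every smaller size. -/
theorem IsAntiIdeal.exists_subset_card_eq {m s k : ℕ} {J : Finset (Fin m × Fin s)}
    (hJ : IsAntiIdeal m s J) (hk : k ≤ J.card) :
    ∃ J' ⊆ J, IsAntiIdeal m s J' ∧ J'.card = k := by
  induction hn : J.card - k generalizing J with
  | zero => exact ⟨J, subset_rfl, hJ, by omega⟩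
  | succ n ih =>
    have hne : J.Nonempty := Finset.card_pos.mp (by omega)
    obtain ⟨p, hp, hmin⟩ := J.exists_min_image Prod.snd hne
    have hcard := Finset.card_erase_of_mem hp
    have hanti : IsAntiIdeal m s (J.erase p) := by
      intro i a b hab ha
      obtain ⟨hne', haJ⟩ := Finset.mem_erase.mp ha
      refine Finset.mem_erase.mpr ⟨?_, hJ i a b hab haJ⟩
      rintro rfl
      exact hne' (Prod.ext rfl (le_antisymm hab (hmin _ haJ)))
    obtain ⟨J', hsub, h⟩ := ih hanti (by rw [hcard]; omega) (by rw [hcard]; omega)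
    exact ⟨J', hsub.trans (J.erase_subset p), h⟩

/-- The complement of the ideal generated by the coordinates where `x` and `y` differ is an
anti-ideal on which `x` and `y` agree. -/
theorem exists_isAntiIdeal_of_nrtDist_le {m s q R : ℕ} {x y : Fin m × Fin s → Fin q}
    (h : nrtDist m s q x y ≤ R) :
    ∃ J : Finset (Fin m × Fin s), IsAntiIdeal m s J ∧ J.card = m * s - R ∧
      ∀ c ∈ J, x c = y c := by
  have hJ : IsAntiIdeal m s (Finset.univ.filter (fun c : Fin m × Fin s =>
      ∃ b : Fin s, c.2 ≤ b ∧ x (c.1, b) ≠ y (c.1, b)))ᶜ := by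
    intro i a b hab ha
    simp only [Finset.mem_compl, Finset.mem_filter, Finset.mem_univ, true_and] at ha ⊢
    rintro ⟨d, hd, hne⟩
    exact ha ⟨d, hab.trans hd, hne⟩
  obtain ⟨J, hsub, hanti, hcard⟩ := hJ.exists_subset_card_eq (k := m * s - R) (by
    rw [Finset.card_compl, Fintype.card_prod, Fintype.card_fin, Fintype.card_fin]
    exact Nat.sub_le_sub_left h _)
  refine ⟨J, hanti, hcard, fun c hc => ?_⟩
  by_contra hne
  exact Finset.mem_compl.mp (hsub hc)
    (Finset.mem_filter.mpr ⟨Finset.mem_univ _, c.2, le_rfl, hne⟩)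

/-- Words agreeing on an anti-ideal of size `m * s - R` are at distance at most `R`. -/
theorem nrtDist_le_of_eqOn {m s q R : ℕ} {x y : Fin m × Fin s → Fin q}
    {J : Finset (Fin m × Fin s)} (hJ : IsAntiIdeal m s J) (hcard : J.card = m * s - R)
    (h : ∀ c ∈ J, x c = y c) : nrtDist m s q x y ≤ R := by
  have hsub : (Finset.univ.filter (fun c : Fin m × Fin s =>
      ∃ b : Fin s, c.2 ≤ b ∧ x (c.1, b) ≠ y (c.1, b))) ⊆ Jᶜ := by
    intro c hc
    obtain ⟨-, b, hb, hne⟩ := Finset.mem_filter.mp hc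
    exact Finset.mem_compl.mpr fun hcJ => hne (h _ (hJ c.1 c.2 b hb hcJ))
  have hle := Finset.card_le_card hsub
  rw [Finset.card_compl, Fintype.card_prod, Fintype.card_fin, Fintype.card_fin, hcard] at hle
  unfold nrtDist
  omega

/-- The array whose rows are all the words is an ordered covering array. -/
theorem exists_isOCA_one (t m s v : ℕ) : ∃ N, IsOCA 1 N t m s v := by
  refine ⟨_, (Fintype.equivFin (Fin m × Fin s → Fin v)).symm, fun J _ _ f => ?_⟩
  refine Finset.card_pos.mpr ⟨Fintype.equivFin _ f, ?_⟩
  simp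

/-- `K_{vq}(m, s, R) ≤ OCAN(ms - R, m, s, v) · K_q(m, s, R)`. -/
theorem stmt_17 (v q m s R : ℕ) (hv : 2 ≤ v) (hq : 2 ≤ q) (hm : 1 ≤ m)
    (hs : 1 ≤ s) (hR1 : 0 < R) (hR2 : R < m * s) :
    nrtK (v * q) m s R ≤ OCAN 1 (m * s - R) m s v * nrtK q m s R := by
  classical
  obtain ⟨A, hA⟩ : IsOCA 1 (OCAN 1 (m * s - R) m s v) (m * s - R) m s v :=
    Nat.sInf_mem (exists_isOCA_one (m * s - R) m s v)
  have hne : {n | ∃ C : Finset (Fin m × Fin s → Fin q), C.card = n ∧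
      ∀ x : Fin m × Fin s → Fin q, ∃ c ∈ C, nrtDist m s q x c ≤ R}.Nonempty :=
    ⟨_, Finset.univ, rfl, fun x => ⟨x, Finset.mem_univ x, by simp [nrtDist]⟩⟩
  obtain ⟨C, hCcard, hC⟩ := Nat.sInf_mem hne
  let word (p : Fin (OCAN 1 (m * s - R) m s v) × (Fin m × Fin s → Fin q)) :
      Fin m × Fin s → Fin (v * q) := fun c => finProdFinEquiv (A p.1 c, p.2 c)
  have hcover : nrtK (v * q) m s R ≤ ((Finset.univ ×ˢ C).image word).card := by
    refine Nat.sInf_le ⟨_, rfl, fun x => ?_⟩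
    obtain ⟨c, hc, hdist⟩ := hC fun i => (finProdFinEquiv.symm (x i)).2
    obtain ⟨J, hJ, hJcard, hagree⟩ := exists_isAntiIdeal_of_nrtDist_le hdist
    obtain ⟨r, hr⟩ := Finset.card_pos.mp
      (hA J hJ hJcard fun i => (finProdFinEquiv.symm (x i)).1)
    have hr := (Finset.mem_filter.mp hr).2
    refine ⟨word (r, c), Finset.mem_image_of_mem _ (by simp [hc]),
      nrtDist_le_of_eqOn hJ hJcard fun i hi => ?_⟩
    change x i = finProdFinEquiv (A r i, c i)
    rw [hr i hi, ← hagree i hi, Prod.mk.eta, Equiv.apply_symm_apply]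
  calc nrtK (v * q) m s R ≤ ((Finset.univ ×ˢ C).image word).card := hcover
    _ ≤ (Finset.univ ×ˢ C).card := Finset.card_image_le
    _ = OCAN 1 (m * s - R) m s v * nrtK q m s R := by
      rw [Finset.card_product, Finset.card_univ, Fintype.card_fin, hCcard, nrtK]
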